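/- Let μ ∈ P^+, τ ∈ T and j ∈ I^{re}. If α_j^∨(τμ) < 0, then ℓ(r_jτ) < ℓ(τ). -/

import Mathlib

namespace GKM

variable {I V : Type*} [AddCommGroup V] [Module ℚ V]

/-- The simple "reflection" `r_i : x ↦ x - α_i^∨(x) • α_i` (an endomorphism of `h*`). -/
def srefl (α : I → V) (coroot : I → (V →ₗ[ℚ] ℚ)) (i : I) : Module.End ℚ V :=
  LinearMap.id - (coroot i).smulRight (α i)

/-- The dual map `h ↦ h - h(α_i) • α_i^∨` on linear functionals; for a real index `i`
this is `r_i^∨ : h ↦ h ∘ r_i⁻¹ = h ∘ r_i`. -/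
def crefl (α : I → V) (coroot : I → (V →ₗ[ℚ] ℚ)) (i : I) :
    Module.End ℚ (V →ₗ[ℚ] ℚ) :=
  LinearMap.id - (LinearMap.applyₗ (α i)).smulRight (coroot i)

/-- The monoid `T` generated by all the `r_i`, `i ∈ I`. -/
def Tmon (α : I → V) (coroot : I → (V →ₗ[ℚ] ℚ)) : Submonoid (Module.End ℚ V) :=
  Submonoid.closure (Set.range (srefl α coroot))

/-- The Weyl group `W` generated by the `r_i` with `i` real; since each generator is an
involution, the submonoid it generates coincides with the group it generates. -/
def Wmon (A : I → I → ℤ) (α : I → V) (coroot : I → (V →ₗ[ℚ] ℚ)) :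
    Submonoid (Module.End ℚ V) :=
  Submonoid.closure (srefl α coroot '' {i | A i i = 2})

/-- `Q^+`, the set of `ℕ`-linear combinations of simple roots. -/
def Qplus (α : I → V) : Set V :=
  {x | ∃ c : I →₀ ℕ, x = c.sum fun i n => (n : ℚ) • α i}

/-- The weight lattice `P`. -/
def Pint (coroot : I → (V →ₗ[ℚ] ℚ)) : Set V :=
  {x | ∀ i, ∃ n : ℤ, coroot i x = (n : ℚ)}

/-- The dominant integral weights `P^+`. -/
def Pplus (coroot : I → (V →ₗ[ℚ] ℚ)) : Set V :=
  {x | (∀ i, ∃ n : ℤ, coroot i x = (n : ℚ)) ∧ ∀ i, 0 ≤ coroot i x}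

/-- The orbit `Tλ`. -/
def Torbit (α : I → V) (coroot : I → (V →ₗ[ℚ] ℚ)) (lam : V) : Set V :=
  {x | ∃ τ, τ ∈ Tmon α coroot ∧ τ lam = x}

/-- The reduced length of `τ ∈ T` with respect to all generators `r_i`, `i ∈ I`. -/
noncomputable def lenT (α : I → V) (coroot : I → (V →ₗ[ℚ] ℚ))
    (τ : Module.End ℚ V) : ℕ :=
  sInf {n | ∃ l : List I, l.length = n ∧ (l.map (srefl α coroot)).prod = τ}

/-- The reduced length of `w ∈ W` with respect to the real generators. -/
noncomputable def lenW (A : I → I → ℤ) (α : I → V) (coroot : I → (V →ₗ[ℚ] ℚ))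
    (w : Module.End ℚ V) : ℕ :=
  sInf {n | ∃ l : List I, (∀ m ∈ l, A m m = 2) ∧ l.length = n ∧
    (l.map (srefl α coroot)).prod = w}

/-- The reflection `r_β : x ↦ x - β^∨(x) • β` attached to a root/coroot pair. -/
def reflRoot (β : V) (βv : V →ₗ[ℚ] ℚ) : Module.End ℚ V :=
  LinearMap.id - βv.smulRight β

/-- A presentation of `β = w α_k ∈ WΠ` together with its coroot `β^∨ = w^∨ α_k^∨`,
via a word `l` (with real entries) for `w`. -/
def IsWRootPres (A : I → I → ℤ) (α : I → V) (coroot : I → (V →ₗ[ℚ] ℚ))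
    (l : List I) (k : I) (β : V) (βv : V →ₗ[ℚ] ℚ) : Prop :=
  (∀ m ∈ l, A m m = 2) ∧
  β = (l.map (srefl α coroot)).prod (α k) ∧
  βv = (l.map (crefl α coroot)).prod (coroot k)

/-- `β ∈ WΠ` with coroot `β^∨`. -/
def IsWRootPair (A : I → I → ℤ) (α : I → V) (coroot : I → (V →ₗ[ℚ] ℚ))
    (β : V) (βv : V →ₗ[ℚ] ℚ) : Prop :=
  ∃ l k, IsWRootPres A α coroot l k β βv

/-- A chain `ν =: c s ← ⋯ ← c 0 := μ` of length `s` inside `Tλ`: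
`c k = r_{β k} (c (k+1))` with `β k ∈ WΠ ∩ Q^+` and `(β k)^∨(c (k+1)) > 0`. -/
def IsChain (A : I → I → ℤ) (α : I → V) (coroot : I → (V →ₗ[ℚ] ℚ))
    (lam μ ν : V) (s : ℕ) (c : ℕ → V) (β : ℕ → V)
    (βv : ℕ → (V →ₗ[ℚ] ℚ)) : Prop :=
  c 0 = μ ∧ c s = ν ∧ (∀ k ≤ s, c k ∈ Torbit α coroot lam) ∧
  ∀ k < s, IsWRootPair A α coroot (β k) (βv k) ∧ β k ∈ Qplus α ∧
    0 < βv k (c (k+1)) ∧ c k = c (k+1) - βv k (c (k+1)) • β k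

/-- `μ > ν` in `Tλ`. -/
def ChainGT (A : I → I → ℤ) (α : I → V) (coroot : I → (V →ₗ[ℚ] ℚ))
    (lam μ ν : V) : Prop :=
  ∃ s, 1 ≤ s ∧ ∃ c β βv, IsChain A α coroot lam μ ν s c β βv

/-- `dist(μ, ν) = n`: there is a chain of length `n` from `μ` to `ν` and every chain
has length at most `n`. -/
def distEq (A : I → I → ℤ) (α : I → V) (coroot : I → (V →ₗ[ℚ] ℚ))
    (lam μ ν : V) (n : ℕ) : Prop :=
  (∃ c β βv, IsChain A α coroot lam μ ν n c β βv) ∧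
  ∀ m c β βv, IsChain A α coroot lam μ ν m c β βv → m ≤ n

/-- An `a`-chain for `(μ, ν)`: a chain in which each step is a covering
(`dist = 1`), `a·β_k^∨(ν_k)` is a positive integer for steps along `WΠ_re`,
and `a·β_k^∨(ν_k) = 1` for steps along `WΠ_im`.  The index `ks k` records the simple
root of which `β k` is a `W`-translate. -/
def IsAChain (A : I → I → ℤ) (α : I → V) (coroot : I → (V →ₗ[ℚ] ℚ))
    (lam : V) (a : ℚ) (μ ν : V) (s : ℕ) (c : ℕ → V)
    (β : ℕ → V) (βv : ℕ → (V →ₗ[ℚ] ℚ)) (ks : ℕ → I) : Prop :=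
  1 ≤ s ∧ IsChain A α coroot lam μ ν s c β βv ∧
  ∀ k < s,
    (∃ l, IsWRootPres A α coroot l (ks k) (β k) (βv k)) ∧
    distEq A α coroot lam (c k) (c (k+1)) 1 ∧
    (A (ks k) (ks k) = 2 → ∃ n : ℕ, 0 < n ∧ a * βv k (c (k+1)) = (n : ℚ)) ∧
    (A (ks k) (ks k) ≠ 2 → a * βv k (c (k+1)) = 1)

/-- Existence of an `a`-chain for `(μ, ν)`. -/
def HasAChain (A : I → I → ℤ) (α : I → V) (coroot : I → (V →ₗ[ℚ] ℚ))
    (lam : V) (a : ℚ) (μ ν : V) : Prop :=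
  ∃ s c β βv ks, IsAChain A α coroot lam a μ ν s c β βv ks

/-- The piecewise-linear path attached to GLS data `(λ_1, …, λ_s ; a_0, …, a_s)`
(weights indexed `1, …, s`, breakpoints indexed `0, …, s`):
on `[a_{j-1}, a_j]` it equals `Σ_{k<j} (a_k - a_{k-1}) • λ_k + (t - a_{j-1}) • λ_j`. -/
def glsPath (lamseq : ℕ → V) (a : ℕ → ℚ) (s : ℕ) (t : ℚ) : V :=
  ∑ k ∈ Finset.range s, (max (min t (a (k+1)) - a k) 0) • lamseq (k+1)

/-- The data of a Generalized Lakshmibai–Seshadri path of shape `lam`. -/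
def IsGLS (A : I → I → ℤ) (α : I → V) (coroot : I → (V →ₗ[ℚ] ℚ))
    (lam : V) (s : ℕ) (lamseq : ℕ → V) (a : ℕ → ℚ) : Prop :=
  1 ≤ s ∧ a 0 = 0 ∧ a s = 1 ∧ (∀ k < s, a k < a (k+1)) ∧
  (∀ k, 1 ≤ k → k ≤ s → lamseq k ∈ Torbit α coroot lam) ∧
  (∀ k, 1 ≤ k → k < s →
    HasAChain A α coroot lam (a k) (lamseq k) (lamseq (k+1))) ∧
  (lamseq s = lam ∨ HasAChain A α coroot lam 1 (lamseq s) lam)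

/-- The set `ℙ_λ` of Generalized Lakshmibai–Seshadri paths of shape `lam`,
realized as functions `ℚ → V` via `glsPath`. -/
def GLSset (A : I → I → ℤ) (α : I → V) (coroot : I → (V →ₗ[ℚ] ℚ))
    (lam : V) : Set (ℚ → V) :=
  {π | ∃ s lamseq a, IsGLS A α coroot lam s lamseq a ∧ π = glsPath lamseq a s}

/-- `h_i^π(t) = α_i^∨(π(t))`. -/
def hFun (coroot : I → (V →ₗ[ℚ] ℚ)) (i : I) (π : ℚ → V) (t : ℚ) : ℚ :=
  coroot i (π t)

/-- `m_i^π`, the minimal integer value attained by `h_i^π` on `[0,1]`. -/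
noncomputable def mOf (coroot : I → (V →ₗ[ℚ] ℚ)) (i : I) (π : ℚ → V) : ℤ :=
  sInf {n : ℤ | ∃ t, 0 ≤ t ∧ t ≤ 1 ∧ hFun coroot i π t = (n : ℚ)}

/-- Two paths agree on `[0,1]`. -/
def pathEq (π π' : ℚ → V) : Prop := ∀ t, 0 ≤ t → t ≤ 1 → π t = π' t

/-- `tp = f_+^i(π)`: the largest point of `[0,1]` where `h_i^π` equals `m_i^π`. -/
def IsFPlus (coroot : I → (V →ₗ[ℚ] ℚ)) (i : I) (π : ℚ → V) (tp : ℚ) : Prop :=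
  0 ≤ tp ∧ tp ≤ 1 ∧ hFun coroot i π tp = (mOf coroot i π : ℚ) ∧
  ∀ t, 0 ≤ t → t ≤ 1 → hFun coroot i π t = (mOf coroot i π : ℚ) → t ≤ tp

/-- `tm = f_-^i(π)`: the smallest point of `[tp,1]` where `h_i^π` equals `m_i^π + 1`. -/
def IsFMinus (coroot : I → (V →ₗ[ℚ] ℚ)) (i : I) (π : ℚ → V) (tp tm : ℚ) : Prop :=
  tp ≤ tm ∧ tm ≤ 1 ∧ hFun coroot i π tm = (mOf coroot i π : ℚ) + 1 ∧
  ∀ t, tp ≤ t → t ≤ 1 → hFun coroot i π t = (mOf coroot i π : ℚ) + 1 → tm ≤ t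

/-- The path `f_i π` (for cutting data `tp = f_+^i(π)`, `tm = f_-^i(π)`). -/
def fPath (α : I → V) (coroot : I → (V →ₗ[ℚ] ℚ)) (i : I) (tp tm : ℚ)
    (π : ℚ → V) (t : ℚ) : V :=
  if t ≤ tp then π t
  else if t ≤ tm then π tp + srefl α coroot i (π t - π tp)
  else π t - α i

/-- `π' = f_i π ≠ 0` (equality of paths on `[0,1]`). -/
def FRel (α : I → V) (coroot : I → (V →ₗ[ℚ] ℚ)) (i : I) (π π' : ℚ → V) : Prop :=
  ∃ tp tm, IsFPlus coroot i π tp ∧ tp < 1 ∧ IsFMinus coroot i π tp tm ∧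
    pathEq π' (fPath α coroot i tp tm π)

/-- `tp = e_+^i(π)` (`i` real): smallest point of `[0,1]` where `h_i^π = m_i^π`. -/
def IsEPlusRe (coroot : I → (V →ₗ[ℚ] ℚ)) (i : I) (π : ℚ → V) (tp : ℚ) : Prop :=
  0 ≤ tp ∧ tp ≤ 1 ∧ hFun coroot i π tp = (mOf coroot i π : ℚ) ∧
  ∀ t, 0 ≤ t → t ≤ 1 → hFun coroot i π t = (mOf coroot i π : ℚ) → tp ≤ t

/-- `tm = e_-^i(π)` (`i` real): largest point of `[0,tp]` where `h_i^π = m_i^π + 1`. -/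
def IsEMinusRe (coroot : I → (V →ₗ[ℚ] ℚ)) (i : I) (π : ℚ → V) (tp tm : ℚ) : Prop :=
  0 ≤ tm ∧ tm ≤ tp ∧ hFun coroot i π tm = (mOf coroot i π : ℚ) + 1 ∧
  ∀ t, 0 ≤ t → t ≤ tp → hFun coroot i π t = (mOf coroot i π : ℚ) + 1 → t ≤ tm

/-- The path `e_i π` for `i` real. -/
def ePathRe (α : I → V) (coroot : I → (V →ₗ[ℚ] ℚ)) (i : I) (tm tp : ℚ)
    (π : ℚ → V) (t : ℚ) : V :=
  if t ≤ tm then π t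
  else if t ≤ tp then π tm + srefl α coroot i (π t - π tm)
  else π t + α i

/-- `π' = e_i π ≠ 0` for a real index `i`. -/
def ERelRe (α : I → V) (coroot : I → (V →ₗ[ℚ] ℚ)) (i : I) (π π' : ℚ → V) : Prop :=
  ∃ tp tm, IsEPlusRe coroot i π tp ∧ 0 < tp ∧ IsEMinusRe coroot i π tp tm ∧
    pathEq π' (ePathRe α coroot i tm tp π)

/-- The "inverse reflection" `r_i^{-1} : x ↦ x + (1/(1-a_{ii})) α_i^∨(x) α_i`
for an imaginary index `i`. -/
def rinv (A : I → I → ℤ) (α : I → V) (coroot : I → (V →ₗ[ℚ] ℚ)) (i : I) :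
    Module.End ℚ V :=
  LinearMap.id + (1 / (1 - (A i i : ℚ))) • (coroot i).smulRight (α i)

/-- `tp = e_+^i(π)` (`i` imaginary): smallest point of `[tm,1]` where
`h_i^π = m_i^π + 1 - a_{ii}` (here `tm = e_-^i(π) = f_+^i(π)`). -/
def IsEPlusIm (A : I → I → ℤ) (coroot : I → (V →ₗ[ℚ] ℚ)) (i : I) (π : ℚ → V)
    (tm tp : ℚ) : Prop :=
  tm ≤ tp ∧ tp ≤ 1 ∧
  hFun coroot i π tp = (mOf coroot i π : ℚ) + 1 - (A i i : ℚ) ∧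
  ∀ t, tm ≤ t → t ≤ 1 →
    hFun coroot i π t = (mOf coroot i π : ℚ) + 1 - (A i i : ℚ) → tp ≤ t

/-- The path `e_i π` for `i` imaginary. -/
def ePathIm (A : I → I → ℤ) (α : I → V) (coroot : I → (V →ₗ[ℚ] ℚ)) (i : I)
    (tm tp : ℚ) (π : ℚ → V) (t : ℚ) : V :=
  if t ≤ tm then π t
  else if t ≤ tp then π tm + rinv A α coroot i (π t - π tm)
  else π t + α i

/-- `π' = e_i π ≠ 0` for an imaginary index `i`:  `e_-^i(π) = f_+^i(π) < 1`, the point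
`e_+^i(π)` exists, and `h_i^π` never drops to `m_i^π - a_{ii}` on `[e_+^i(π), 1]`. -/
def ERelIm (A : I → I → ℤ) (α : I → V) (coroot : I → (V →ₗ[ℚ] ℚ)) (i : I)
    (π π' : ℚ → V) : Prop :=
  ∃ tm tp, IsFPlus coroot i π tm ∧ tm < 1 ∧ IsEPlusIm A coroot i π tm tp ∧
    (∀ t, tp ≤ t → t ≤ 1 →
      (mOf coroot i π : ℚ) - (A i i : ℚ) < hFun coroot i π t) ∧
    pathEq π' (ePathIm A α coroot i tm tp π)

/-- `π' = e_i π ≠ 0`. -/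
def ERel (A : I → I → ℤ) (α : I → V) (coroot : I → (V →ₗ[ℚ] ℚ)) (i : I)
    (π π' : ℚ → V) : Prop :=
  (A i i = 2 ∧ ERelRe α coroot i π π') ∨ (A i i ≠ 2 ∧ ERelIm A α coroot i π π')

/-- `π' = f_{i_1} ⋯ f_{i_k} π ≠ 0` for a list `[i_1, …, i_k]` (rightmost acts first). -/
def FMonRel (α : I → V) (coroot : I → (V →ₗ[ℚ] ℚ)) :
    List I → (ℚ → V) → (ℚ → V) → Prop
  | [], π, π' => pathEq π π'
  | i :: l, π, π' => ∃ πm, FMonRel α coroot l π πm ∧ FRel α coroot i πm π'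

/-- A generalized crystal for the Borcherds–Cartan datum `(A, α, coroot)`. -/
structure GenCrystal (A : I → I → ℤ) (α : I → V)
    (coroot : I → (V →ₗ[ℚ] ℚ)) where
  B : Type*
  wt : B → V
  wt_int : ∀ (i : I) (b : B), ∃ n : ℤ, coroot i (wt b) = (n : ℚ)
  eps : I → B → WithBot ℤ
  phi : I → B → WithBot ℤ
  e : I → B → Option B
  f : I → B → Option B
  phi_eq : ∀ (i : I) (b : B) (n : ℤ), (n : ℚ) = coroot i (wt b) →
    phi i b = eps i b + (n : WithBot ℤ)
  wt_e : ∀ (i : I) (b b' : B), e i b = some b' → wt b' = wt b + α i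
  eps_e_re : ∀ (i : I) (b b' : B), A i i = 2 → e i b = some b' →
    eps i b' = eps i b + ((-1 : ℤ) : WithBot ℤ)
  eps_e_im : ∀ (i : I) (b b' : B), A i i ≠ 2 → e i b = some b' →
    eps i b' = eps i b
  e_iff_f : ∀ (i : I) (b b' : B), e i b = some b' ↔ f i b' = some b
  phi_bot : ∀ (i : I) (b : B), phi i b = ⊥ → e i b = none ∧ f i b = none
  eps_im : ∀ (i : I) (b : B), A i i ≠ 2 → eps i b ≤ 0
  phi_im : ∀ (i : I) (b : B), A i i ≠ 2 → phi i b = ⊥ ∨ 0 ≤ phi i b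

/-- Finite "orthogonal" subsets of the imaginary simple roots, encoded by their
index sets: `F ∈ 𝒫(Π_im)`. -/
def PImSet (A : I → I → ℤ) (F : Finset I) : Prop :=
  (∀ i ∈ F, A i i ≠ 2) ∧ ∀ i ∈ F, ∀ j ∈ F, i ≠ j → A i j = 0

end GKM

namespace GKM

/-- The pairing of the `i`-th formal simple coroot with a formal root-lattice element. -/
noncomputable def formalPairing {I : Type*} (B : I → I → ℤ) (i : I) : (I →₀ ℤ) →ₗ[ℤ] ℤ :=
  Finsupp.linearCombination ℤ (B i)

/-- The `i`-th simple reflection on the formal root lattice. -/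
noncomputable def formalRefl {I : Type*} (B : I → I → ℤ) (i : I) : Module.End ℤ (I →₀ ℤ) :=
  LinearMap.id - (formalPairing B i).smulRight (Finsupp.single i 1)

/-- The action of a word in the simple reflections on the formal root lattice. -/
noncomputable def formalAct {I : Type*} (B : I → I → ℤ) (l : List I) : Module.End ℤ (I →₀ ℤ) :=
  (l.map (formalRefl B)).prod

/-- The bilinear pairing between the formal coroot lattice and the formal root lattice. -/
noncomputable def formalBil {I : Type*} (B : I → I → ℤ) :
    (I →₀ ℤ) →ₗ[ℤ] (I →₀ ℤ) →ₗ[ℤ] ℤ :=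
  Finsupp.linearCombination ℤ (formalPairing B)

/-- Generalized Cartan matrices (possibly of infinite size). -/
structure IsGCM {I : Type*} (B : I → I → ℤ) : Prop where
  diag : ∀ i, B i i = 2
  off : ∀ i j, i ≠ j → B i j ≤ 0
  zero : ∀ i j, B i j = 0 ↔ B j i = 0

/-- The order of a product of two distinct simple reflections in terms of the product of the
two off-diagonal Cartan integers (`0` encodes infinite order). -/
def braidOrder (k : ℤ) : ℕ :=
  if k = 0 then 2 else if k = 1 then 3 else if k = 2 then 4 else if k = 3 then 6 else 0

/-- The coefficients of `⋯ s t s t (e_s)`, where `s t (e_s) = e_s + b e_t`, etc. -/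
def dihedralCoeff (a b : ℤ) : ℕ → ℤ × ℤ
  | 0 => (1, 0)
  | n + 1 =>
    let c := dihedralCoeff a b n
    if Even n then (c.1, b * c.1 - c.2) else (a * c.2 - c.1, c.2)

section FormalReflections

variable {I : Type*} {B : I → I → ℤ}

theorem IsGCM.transpose (hB : IsGCM B) : IsGCM (fun i j => B j i) :=
  ⟨hB.diag, fun i j h => hB.off j i h.symm, fun i j => hB.zero j i⟩

@[simp] theorem formalPairing_single (i j : I) (c : ℤ) :
    formalPairing B i (Finsupp.single j c) = c * B i j := by
  simp [formalPairing, Finsupp.linearCombination_single]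

theorem formalRefl_apply (i : I) (x : I →₀ ℤ) :
    formalRefl B i x = x - formalPairing B i x • Finsupp.single i 1 := rfl

theorem formalRefl_apply_of_ne {i j : I} (h : j ≠ i) (x : I →₀ ℤ) :
    formalRefl B i x j = x j := by
  simp [formalRefl_apply, Finsupp.single_eq_of_ne h]

theorem formalRefl_single_self {i : I} (h : B i i = 2) :
    formalRefl B i (Finsupp.single i 1) = -Finsupp.single i 1 := by
  rw [formalRefl_apply, formalPairing_single, h]; module

theorem formalRefl_mul_self {i : I} (h : B i i = 2) : formalRefl B i * formalRefl B i = 1 := by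
  refine LinearMap.ext fun x => ?_
  simp only [Module.End.mul_apply, Module.End.one_apply, formalRefl_apply, map_sub, map_smul,
    formalPairing_single, h]
  module

theorem formalRefl_comb_left {i j : I} (h : B i i = 2) (x : I →₀ ℤ) (p q : ℤ) :
    formalRefl B i (x + p • Finsupp.single i 1 + q • Finsupp.single j 1) =
      x + (-p - formalPairing B i x - q * B i j) • Finsupp.single i 1 +
        q • Finsupp.single j 1 := by
  simp only [formalRefl_apply, map_add, map_smul, formalPairing_single, h]
  module

theorem formalRefl_comb_right {i j : I} (h : B j j = 2) (x : I →₀ ℤ) (p q : ℤ) :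
    formalRefl B j (x + p • Finsupp.single i 1 + q • Finsupp.single j 1) =
      x + p • Finsupp.single i 1 +
        (-q - formalPairing B j x - p * B j i) • Finsupp.single j 1 := by
  simp only [formalRefl_apply, map_add, map_smul, formalPairing_single, h]
  module

theorem eq_or_eq_of_mul_eq_two_or_three {a b : ℤ} (ha : a ≤ 0) (hb : b ≤ 0) {k : ℤ}
    (hk : a * b = k) (h : k = 1 ∨ k = 2 ∨ k = 3) :
    a = -1 ∧ b = -k ∨ a = -k ∧ b = -1 := by
  have hb' : b ≤ -1 := by
    rcases hb.lt_or_eq with hb | rfl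
    · lia
    · lia
  have hk3 : k ≤ 3 := by lia
  have ha' : -3 ≤ a := by
    subst hk
    nlinarith [mul_nonneg (neg_nonneg.2 ha) (show 0 ≤ -1 - b by lia)]
  interval_cases a <;> lia

theorem formalRefl_mul_pow (hB : IsGCM B) {i j : I} (hij : i ≠ j) :
    (formalRefl B i * formalRefl B j) ^ braidOrder (B i j * B j i) = 1 := by
  have hii := hB.diag i
  have hjj := hB.diag j
  have ha := hB.off i j hij
  have hb := hB.off j i hij.symm
  refine LinearMap.ext fun x => ?_
  have hx : x = x + (0 : ℤ) • Finsupp.single i 1 + (0 : ℤ) • Finsupp.single j 1 := by module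
  unfold braidOrder
  split_ifs with h0 h1 h2 h3
  · have hij0 : B i j = 0 := by
      rcases mul_eq_zero.1 h0 with h | h
      · exact h
      · exact (hB.zero i j).2 h
    have hji0 := (hB.zero i j).1 hij0
    conv_lhs => rw [hx]
    simp only [pow_succ, pow_zero, one_mul, Module.End.mul_apply, Module.End.one_apply,
      formalRefl_comb_left hii, formalRefl_comb_right hjj, hij0, hji0]
    module
  · rcases eq_or_eq_of_mul_eq_two_or_three ha hb h1 (by simp) with ⟨h, h'⟩ | ⟨h, h'⟩ <;>
    · conv_lhs => rw [hx]
      simp only [pow_succ, pow_zero, one_mul, Module.End.mul_apply, Module.End.one_apply,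
        formalRefl_comb_left hii, formalRefl_comb_right hjj, h, h']
      module
  · rcases eq_or_eq_of_mul_eq_two_or_three ha hb h2 (by simp) with ⟨h, h'⟩ | ⟨h, h'⟩ <;>
    · conv_lhs => rw [hx]
      simp only [pow_succ, pow_zero, one_mul, Module.End.mul_apply, Module.End.one_apply,
        formalRefl_comb_left hii, formalRefl_comb_right hjj, h, h']
      module
  · rcases eq_or_eq_of_mul_eq_two_or_three ha hb h3 (by simp) with ⟨h, h'⟩ | ⟨h, h'⟩ <;>
    · conv_lhs => rw [hx]
      simp only [pow_succ, pow_zero, one_mul, Module.End.mul_apply, Module.End.one_apply,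
        formalRefl_comb_left hii, formalRefl_comb_right hjj, h, h']
      module
  · simp

theorem dihedralCoeff_nonneg_of_four_le {a b : ℤ} (ha : 0 ≤ a) (hb : 0 ≤ b) (hab : 4 ≤ a * b)
    (n : ℕ) :
    0 ≤ (dihedralCoeff a b n).1 ∧ 0 ≤ (dihedralCoeff a b n).2 ∧
      (Even n → 2 * (dihedralCoeff a b n).2 ≤ b * (dihedralCoeff a b n).1) ∧
      (¬ Even n → 2 * (dihedralCoeff a b n).1 ≤ a * (dihedralCoeff a b n).2) := by
  induction n with
  | zero => simp [dihedralCoeff, hb]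
  | succ n ih =>
    obtain ⟨hp, hq, he, ho⟩ := ih
    simp only [dihedralCoeff]
    generalize (dihedralCoeff a b n).1 = p at *
    generalize (dihedralCoeff a b n).2 = q at *
    by_cases hn : Even n
    · have he := he hn
      simp only [hn, if_true, Nat.even_add_one, not_true, false_imp_iff, not_false_eq_true,
        true_imp_iff]
      refine ⟨hp, by lia, trivial, ?_⟩
      nlinarith [mul_le_mul_of_nonneg_right hab hp, mul_le_mul_of_nonneg_left he ha]
    · have ho := ho hn
      simp only [hn, if_false, Nat.even_add_one, not_true, false_imp_iff, not_false_eq_true,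
        true_imp_iff]
      refine ⟨by lia, hq, ?_, trivial⟩
      nlinarith [mul_le_mul_of_nonneg_right hab hq, mul_le_mul_of_nonneg_left ho hb]

theorem dihedralCoeff_nonneg {a b : ℤ} (ha : 0 ≤ a) (hb : 0 ≤ b) (hab : a = 0 ↔ b = 0) (n : ℕ)
    (hn : braidOrder (a * b) ≠ 0 → n < braidOrder (a * b)) :
    0 ≤ (dihedralCoeff a b n).1 ∧ 0 ≤ (dihedralCoeff a b n).2 := by
  by_cases h4 : 4 ≤ a * b
  · exact ⟨(dihedralCoeff_nonneg_of_four_le ha hb h4 n).1,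
      (dihedralCoeff_nonneg_of_four_le ha hb h4 n).2.1⟩
  have hab0 : 0 ≤ a * b := mul_nonneg ha hb
  by_cases h0 : a * b = 0
  · have ha0 : a = 0 := by
      rcases mul_eq_zero.1 h0 with h | h
      · exact h
      · exact hab.2 h
    obtain rfl := hab.1 ha0
    subst ha0
    have : n < 2 := by simpa [braidOrder] using hn
    interval_cases n <;> simp [dihedralCoeff]
  have hk : -a * -b = a * b := by ring
  have hk' : a * b = 1 ∨ a * b = 2 ∨ a * b = 3 := by lia
  have key := eq_or_eq_of_mul_eq_two_or_three (neg_nonpos.2 ha) (neg_nonpos.2 hb) hk hk'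
  rcases hk' with h | h | h <;> rw [h] at hn key <;> simp [braidOrder] at hn <;>
    rcases key with ⟨h1, h2⟩ | ⟨h1, h2⟩ <;> rw [neg_inj] at h1 h2 <;> subst h1 h2 <;>
    interval_cases n <;> decide

end FormalReflections

section Positivity

variable {I W : Type*} [Group W] {M : CoxeterMatrix I} (cs : CoxeterSystem M W)

open CoxeterSystem

theorem exists_eq_mul_alternatingWord (w : W) (s t : I) (hs : ¬ cs.IsRightDescent w s) :
    ∃ (v : W) (n : ℕ), w = v * cs.wordProd (alternatingWord s t n) ∧
      cs.length w = cs.length v + n ∧ ¬ cs.IsRightDescent v s ∧ ¬ cs.IsRightDescent v t := by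
  induction hn : cs.length w using Nat.strong_induction_on generalizing w s t with
  | _ N ih =>
    subst hn
    by_cases ht : cs.IsRightDescent w t
    · obtain ⟨v, n, hv, hl, h1, h2⟩ := ih _ ht (w * cs.simple t) t s
        (cs.isRightDescent_iff_not_isRightDescent_mul.1 ht) rfl
      refine ⟨v, n + 1, ?_, ?_, h2, h1⟩
      · rw [alternatingWord_succ, wordProd_concat, ← mul_assoc, ← hv,
          simple_mul_simple_cancel_right]
      · have := cs.isRightDescent_iff.1 ht
        lia
    · exact ⟨w, 0, by simp [alternatingWord], by simp, hs, ht⟩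

variable {B : I → I → ℤ} (ρ : W →* Module.End ℤ (I →₀ ℤ))

theorem map_alternatingWord_single (hB : IsGCM B) (hρ : ∀ i, ρ (cs.simple i) = formalRefl B i)
    (s t : I) (n : ℕ) :
    ρ (cs.wordProd (alternatingWord s t n)) (Finsupp.single s 1) =
      (dihedralCoeff (-B s t) (-B t s) n).1 • Finsupp.single s 1 +
      (dihedralCoeff (-B s t) (-B t s) n).2 • Finsupp.single t 1 := by
  induction n with
  | zero => simp [alternatingWord, dihedralCoeff]
  | succ n ih =>
    rw [alternatingWord_succ', wordProd_cons, map_mul, Module.End.mul_apply, ih, hρ]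
    simp only [dihedralCoeff]
    split_ifs
    · simp only [formalRefl_apply, map_add, map_smul, formalPairing_single, hB.diag]
      module
    · simp only [formalRefl_apply, map_add, map_smul, formalPairing_single, hB.diag]
      module

theorem map_single_nonneg_of_not_isRightDescent (hB : IsGCM B)
    (hM : ∀ i j, i ≠ j → M i j = braidOrder (B i j * B j i))
    (hρ : ∀ i, ρ (cs.simple i) = formalRefl B i) (w : W) (s : I)
    (hs : ¬ cs.IsRightDescent w s) : 0 ≤ ρ w (Finsupp.single s 1) := by
  induction hn : cs.length w using Nat.strong_induction_on generalizing w s with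
  | _ N ih =>
    subst hn
    by_cases hw : w = 1
    · subst hw
      simp
    obtain ⟨t, ht⟩ := cs.exists_rightDescent_of_ne_one hw
    have hst : s ≠ t := by rintro rfl; exact hs ht
    obtain ⟨v, n, hv, hl, h1, h2⟩ := exists_eq_mul_alternatingWord cs w s t hs
    have hn0 : n ≠ 0 := by
      rintro rfl
      simp only [alternatingWord, wordProd_nil, mul_one] at hv
      exact h2 (hv ▸ ht)
    have hred : cs.IsReduced (alternatingWord t s (n + 1)) := by
      have e1 : w * cs.simple s = v * cs.wordProd (alternatingWord t s (n + 1)) := by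
        rw [alternatingWord_succ, wordProd_concat, ← mul_assoc, ← hv]
      have e2 := cs.not_isRightDescent_iff.1 hs
      have e3 := cs.length_mul_le v (cs.wordProd (alternatingWord t s (n + 1)))
      have e4 := cs.length_wordProd_le (alternatingWord t s (n + 1))
      rw [← e1] at e3
      rw [length_alternatingWord] at e4
      rw [CoxeterSystem.IsReduced, length_alternatingWord]
      lia
    have hc := dihedralCoeff_nonneg (a := -B s t) (b := -B t s)
      (neg_nonneg.2 (hB.off _ _ hst)) (neg_nonneg.2 (hB.off _ _ hst.symm))
      (by simpa using hB.zero s t) n (by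
        have e : -B s t * -B t s = B t s * B s t := by ring
        rw [e, ← hM t s hst.symm]
        intro h
        by_contra hlt
        exact cs.not_isReduced_alternatingWord t s h (m := n + 1) (by lia) hred)
    rw [hv, map_mul, Module.End.mul_apply, map_alternatingWord_single cs ρ hB hρ, map_add,
      map_smul, map_smul]
    have i1 := ih _ (by lia) v s h1 rfl
    have i2 := ih _ (by lia) v t h2 rfl
    exact add_nonneg (smul_nonneg hc.1 i1) (smul_nonneg hc.2 i2)

theorem map_single_nonpos_of_isRightDescent (hB : IsGCM B)
    (hM : ∀ i j, i ≠ j → M i j = braidOrder (B i j * B j i))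
    (hρ : ∀ i, ρ (cs.simple i) = formalRefl B i) (w : W) (s : I)
    (hs : cs.IsRightDescent w s) : ρ w (Finsupp.single s 1) ≤ 0 := by
  have h := map_single_nonneg_of_not_isRightDescent cs ρ hB hM hρ _ s
    (cs.isRightDescent_iff_not_isRightDescent_mul.1 hs)
  rw [map_mul, Module.End.mul_apply, hρ, formalRefl_single_self (hB.diag s), map_neg] at h
  exact neg_nonneg.1 h

end Positivity

section SignCoherence

variable {I : Type*} {B : I → I → ℤ}

open Classical in
/-- The Coxeter matrix of the Weyl group of a generalized Cartan matrix. -/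
noncomputable def IsGCM.coxeterMatrix (_ : IsGCM B) : CoxeterMatrix I where
  M := Matrix.of fun i j => if i = j then 1 else braidOrder (B i j * B j i)
  isSymm := by
    ext i j
    simp [eq_comm, mul_comm]
  diagonal i := by simp
  off_diagonal i j h := by
    simp only [Matrix.of_apply, h, if_false, braidOrder]
    split_ifs <;> simp

theorem IsGCM.coxeterMatrix_of_ne (hB : IsGCM B) {i j : I} (h : i ≠ j) :
    hB.coxeterMatrix i j = braidOrder (B i j * B j i) := by
  change (Matrix.of fun i j => _) i j = _
  rw [Matrix.of_apply, if_neg h]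

theorem isLiftable_formalRefl (hB : IsGCM B) {M : CoxeterMatrix I}
    (hM : ∀ i j, i ≠ j → M i j = braidOrder (B i j * B j i)) :
    M.IsLiftable (formalRefl B) := by
  intro i j
  by_cases h : i = j
  · subst h
    rw [M.diagonal, pow_one, formalRefl_mul_self (hB.diag i)]
  · rw [hM i j h, formalRefl_mul_pow hB h]

/-- A real root and its coroot are simultaneously positive or simultaneously negative. -/
theorem formalAct_sign_coherent (hB : IsGCM B) (l : List I) (k : I) :
    (0 ≤ formalAct B l (Finsupp.single k 1) ∧
      0 ≤ formalAct (fun i j => B j i) l (Finsupp.single k 1)) ∨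
    (formalAct B l (Finsupp.single k 1) ≤ 0 ∧
      formalAct (fun i j => B j i) l (Finsupp.single k 1) ≤ 0) := by
  have hM : ∀ i j, i ≠ j → hB.coxeterMatrix i j = braidOrder (B i j * B j i) :=
    fun i j h => hB.coxeterMatrix_of_ne h
  have hM' : ∀ i j, i ≠ j → hB.coxeterMatrix i j = braidOrder (B j i * B i j) :=
    fun i j h => by rw [hM i j h, mul_comm]
  set cs := hB.coxeterMatrix.toCoxeterSystem
  have hL := isLiftable_formalRefl hB hM
  have hL' := isLiftable_formalRefl hB.transpose hM'
  have hρ : ∀ i, cs.lift ⟨_, hL⟩ (cs.simple i) = formalRefl B i :=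
    fun i => cs.lift_apply_simple hL i
  have hρ' : ∀ i, cs.lift ⟨_, hL'⟩ (cs.simple i) = formalRefl (fun i j => B j i) i :=
    fun i => cs.lift_apply_simple hL' i
  have e : formalAct B l = cs.lift ⟨_, hL⟩ (cs.wordProd l) := by
    simp only [formalAct, CoxeterSystem.wordProd, map_list_prod, List.map_map]
    congr 2
  have e' : formalAct (fun i j => B j i) l = cs.lift ⟨_, hL'⟩ (cs.wordProd l) := by
    simp only [formalAct, CoxeterSystem.wordProd, map_list_prod, List.map_map]
    congr 2
  rw [e, e']
  by_cases hd : cs.IsRightDescent (cs.wordProd l) k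
  · exact Or.inr ⟨map_single_nonpos_of_isRightDescent cs _ hB hM hρ _ k hd,
      map_single_nonpos_of_isRightDescent cs _ hB.transpose hM' hρ' _ k hd⟩
  · exact Or.inl ⟨map_single_nonneg_of_not_isRightDescent cs _ hB hM hρ _ k hd,
      map_single_nonneg_of_not_isRightDescent cs _ hB.transpose hM' hρ' _ k hd⟩

end SignCoherence

section RealRoots

variable {I : Type*} {B : I → I → ℤ}

@[simp] theorem formalAct_nil : formalAct B [] = 1 := rfl

@[simp] theorem formalAct_cons (i : I) (l : List I) (x : I →₀ ℤ) :
    formalAct B (i :: l) x = formalRefl B i (formalAct B l x) := by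
  simp [formalAct]

theorem formalAct_append (l l' : List I) (x : I →₀ ℤ) :
    formalAct B (l ++ l') x = formalAct B l (formalAct B l' x) := by
  simp [formalAct]

theorem formalAct_reverse_apply (hB : ∀ i, B i i = 2) (l : List I) (x : I →₀ ℤ) :
    formalAct B l.reverse (formalAct B l x) = x := by
  induction l generalizing x with
  | nil => simp
  | cons i l ih =>
    rw [List.reverse_cons, formalAct_append, formalAct_cons, formalAct_cons, formalAct_nil,
      Module.End.one_apply, ← Module.End.mul_apply (formalRefl B i),
      formalRefl_mul_self (hB i), Module.End.one_apply, ih]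

theorem formalAct_apply_of_notMem {i : I} {l : List I} (h : i ∉ l) (x : I →₀ ℤ) :
    formalAct B l x i = x i := by
  induction l with
  | nil => simp
  | cons j l ih =>
    rw [List.mem_cons, not_or] at h
    rw [formalAct_cons, formalRefl_apply_of_ne h.1, ih h.2]

theorem formalBil_single_left (i : I) (y : I →₀ ℤ) :
    formalBil B (Finsupp.single i 1) y = formalPairing B i y := by
  simp [formalBil, Finsupp.linearCombination_single]

theorem formalBil_single_right (x : I →₀ ℤ) (j : I) :
    formalBil B x (Finsupp.single j 1) = formalPairing (fun i j => B j i) j x := by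
  induction x using Finsupp.induction_linear with
  | zero => simp
  | add x y hx hy => rw [map_add, LinearMap.add_apply, hx, hy, map_add]
  | single i c => simp [formalBil, Finsupp.linearCombination_single]

theorem formalBil_formalRefl (i : I) (x y : I →₀ ℤ) :
    formalBil B (formalRefl (fun i j => B j i) i x) y = formalBil B x (formalRefl B i y) := by
  rw [formalRefl_apply, formalRefl_apply, map_sub, map_sub, map_smul, map_smul,
    LinearMap.sub_apply, LinearMap.smul_apply, formalBil_single_left, formalBil_single_right,
    smul_eq_mul, smul_eq_mul, mul_comm]

theorem formalBil_formalAct (l : List I) (x y : I →₀ ℤ) :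
    formalBil B (formalAct (fun i j => B j i) l x) y =
      formalBil B x (formalAct B l.reverse y) := by
  induction l generalizing y with
  | nil => simp
  | cons i l ih =>
    rw [formalAct_cons, formalBil_formalRefl, ih, List.reverse_cons, formalAct_append]
    simp

/-- A formal real coroot with a positive coefficient is positive. -/
theorem formalAct_nonneg_of_pos (hB : IsGCM B) (l : List I) (k i : I)
    (h : 0 < formalAct B l (Finsupp.single k 1) i) : 0 ≤ formalAct B l (Finsupp.single k 1) := by
  rcases formalAct_sign_coherent hB l k with h' | h'
  · exact h'.1
  · exact absurd (h'.1 i) (not_le.2 h)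

/-- A simple root orthogonal to a real coroot has its coroot orthogonal to the real root. -/
theorem formalPairing_eq_zero_of_transpose (hB : IsGCM B) (l : List I) (k i : I)
    (h : formalPairing (fun i j => B j i) i
      (formalAct (fun i j => B j i) l (Finsupp.single k 1)) = 0) :
    formalPairing B i (formalAct B l (Finsupp.single k 1)) = 0 := by
  set c := formalPairing B i (formalAct B l (Finsupp.single k 1)) with hc
  set δ := formalAct B l.reverse (Finsupp.single i 1) with hδ
  have hkδ : formalPairing B k δ = 0 := by
    rw [hδ, ← formalBil_single_left, ← formalBil_formalAct, formalBil_single_right, h]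
  have hU : formalAct B (l.reverse ++ i :: l) (Finsupp.single k 1) =
      Finsupp.single k 1 - c • δ := by
    rw [formalAct_append, formalAct_cons, formalRefl_apply, map_sub, map_smul,
      formalAct_reverse_apply hB.diag]
  have hU' : formalAct (fun i j => B j i) (l.reverse ++ i :: l) (Finsupp.single k 1) =
      Finsupp.single k 1 := by
    rw [formalAct_append, formalAct_cons, formalRefl_apply, h, zero_smul, sub_zero,
      formalAct_reverse_apply (B := fun i j => B j i) hB.diag]
  have h1 := formalAct_sign_coherent hB (k :: (l.reverse ++ i :: l)) k
  have h2 := formalAct_sign_coherent hB (l.reverse ++ i :: l ++ [k]) k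
  have hk : formalRefl B k (Finsupp.single k 1) = -Finsupp.single k 1 :=
    formalRefl_single_self (hB.diag k)
  have hk' : formalRefl (fun i j => B j i) k (Finsupp.single k 1) = -Finsupp.single k 1 :=
    formalRefl_single_self (B := fun i j => B j i) (hB.diag k)
  rw [formalAct_cons, formalAct_cons, hU, hU', map_sub, map_smul, hk, hk',
    formalRefl_apply k δ, hkδ, zero_smul, sub_zero] at h1
  rw [formalAct_append (l.reverse ++ i :: l) [k], formalAct_append (l.reverse ++ i :: l) [k],
    formalAct_cons, formalAct_cons, formalAct_nil, formalAct_nil, Module.End.one_apply, hk,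
    hk', map_neg, map_neg, hU, hU'] at h2
  have hneg : ¬ (0 : I →₀ ℤ) ≤ -Finsupp.single k 1 := by
    intro h
    have := h k
    simp at this
  have h1 := (h1.resolve_left fun h => hneg h.2).1
  have h2 := (h2.resolve_left fun h => hneg h.2).1
  by_contra hc0
  have hδk : δ = δ k • Finsupp.single k 1 := by
    ext j
    by_cases hj : j = k
    · subst hj; simp
    · have e1 := h1 j
      have e2 := h2 j
      simp only [Finsupp.coe_sub, Finsupp.coe_neg, Finsupp.coe_smul, Pi.sub_apply, Pi.neg_apply,
        Pi.smul_apply, Finsupp.single_eq_of_ne hj, Finsupp.coe_zero, Pi.zero_apply,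
        smul_eq_mul] at e1 e2
      have : c * δ j = 0 := by lia
      simp [Finsupp.single_eq_of_ne hj, (mul_eq_zero.1 this).resolve_left hc0]
  rw [hδk, map_smul, formalPairing_single, hB.diag, smul_eq_mul] at hkδ
  have hδ0 : δ = 0 := by
    rw [hδk, show δ k = 0 by lia, zero_smul]
  have := formalAct_reverse_apply hB.diag l.reverse (Finsupp.single i 1)
  rw [← hδ, hδ0, map_zero] at this
  simpa using DFunLike.congr_fun this i

/-- A positive real root made negative by a simple reflection is the simple root, and likewise
for its coroot. -/
theorem eq_single_of_formalRefl_nonpos (hB : IsGCM B) (l : List I) (k i : I)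
    {γ β : I →₀ ℤ} (hγ : γ = formalAct B l (Finsupp.single k 1))
    (hβ : β = formalAct (fun i j => B j i) l (Finsupp.single k 1))
    (hγ0 : 0 ≤ γ) (hβ0 : 0 ≤ β) (hγ' : formalRefl B i γ ≤ 0)
    (hβ' : formalRefl (fun i j => B j i) i β ≤ 0) :
    γ = Finsupp.single i 1 ∧ β = Finsupp.single i 1 := by
  have hγi : γ = γ i • Finsupp.single i 1 := by
    ext j
    by_cases hj : j = i
    · subst hj; simp
    · have := hγ' j
      rw [formalRefl_apply_of_ne hj] at this
      simpa [Finsupp.single_eq_of_ne hj] using le_antisymm this (hγ0 j)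
  have hβi : β = β i • Finsupp.single i 1 := by
    ext j
    by_cases hj : j = i
    · subst hj; simp
    · have := hβ' j
      rw [formalRefl_apply_of_ne hj] at this
      simpa [Finsupp.single_eq_of_ne hj] using le_antisymm this (hβ0 j)
  have hbil : formalBil B β γ = 2 := by
    rw [hβ, formalBil_formalAct, hγ, formalAct_reverse_apply hB.diag, formalBil_single_left,
      formalPairing_single, hB.diag, one_mul]
  rw [hγi, hβi, map_smul, map_smul, LinearMap.smul_apply, formalBil_single_left,
    formalPairing_single, hB.diag, smul_eq_mul, smul_eq_mul] at hbil
  have h1 : γ i * β i = 1 := by lia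
  have hγ1 : γ i = 1 := Int.eq_one_or_neg_one_of_mul_eq_one h1 |>.resolve_right fun h => by
    have := hγ0 i
    rw [h] at this
    simp at this
  rw [hγ1, one_mul] at h1
  exact ⟨by rw [hγi, hγ1, one_smul], by rw [hβi, h1, one_smul]⟩

end RealRoots

section BorcherdsCartan

variable {I : Type*} {A : I → I → ℤ}

open Classical in
/-- The generalized Cartan matrix obtained by making all simple roots real. -/
noncomputable def realify (A : I → I → ℤ) : I → I → ℤ := fun i j => if i = j then 2 else A i j

theorem isGCM_realify (hoff : ∀ i j, i ≠ j → A i j ≤ 0) (hzero : ∀ i j, A i j = 0 ↔ A j i = 0) :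
    IsGCM (realify A) where
  diag i := by simp [realify]
  off i j h := by simpa [realify, h] using hoff i j h
  zero i j := by
    by_cases h : i = j
    · simp [h]
    · simpa [realify, h, Ne.symm h] using hzero i j

theorem realify_transpose : realify (fun i j => A j i) = fun i j => realify A j i := by
  funext i j
  by_cases h : i = j
  · simp [realify, h]
  · simp [realify, h, Ne.symm h]

theorem isGCM_realify_transpose (hA : IsGCM (realify A)) : IsGCM (realify fun i j => A j i) := by
  rw [realify_transpose]
  exact hA.transpose

theorem formalRefl_realify_of_eq_two {i : I} (h : A i i = 2) :
    formalRefl (realify A) i = formalRefl A i := by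
  have : realify A i = A i := by
    funext j
    by_cases hj : i = j
    · subst hj; simp [realify, h]
    · simp [realify, hj]
  unfold formalRefl formalPairing
  rw [this]

theorem formalAct_realify {l : List I} (h : ∀ m ∈ l, A m m = 2) :
    formalAct (realify A) l = formalAct A l := by
  unfold formalAct
  congr 1
  exact List.map_congr_left fun m hm => formalRefl_realify_of_eq_two (h m hm)

theorem formalPairing_realify {i : I} {x : I →₀ ℤ} (h : x i = 0) :
    formalPairing (realify A) i x = formalPairing A i x := by
  unfold formalPairing
  rw [Finsupp.linearCombination_apply, Finsupp.linearCombination_apply]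
  refine Finsupp.sum_congr fun j hj => ?_
  have : i ≠ j := by
    rintro rfl
    exact Finsupp.mem_support_iff.1 hj h
  simp [realify, this]

theorem formalPairing_nonpos (hoff : ∀ i j, i ≠ j → A i j ≤ 0) {i : I} (hi : A i i ≤ 0)
    {x : I →₀ ℤ} (hx : 0 ≤ x) : formalPairing A i x ≤ 0 := by
  unfold formalPairing
  rw [Finsupp.linearCombination_apply]
  refine Finsupp.sum_nonpos fun j _ => ?_
  rw [smul_eq_mul]
  refine mul_nonpos_of_nonneg_of_nonpos (hx j) ?_
  by_cases h : i = j
  · subst h; exact hi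
  · exact hoff i j h

/-- Elements all of whose translates under words in real reflections are nonnegative. -/
def IsWeylPositive (A : I → I → ℤ) (x : I →₀ ℤ) : Prop :=
  ∀ l : List I, (∀ m ∈ l, A m m = 2) → 0 ≤ formalAct A l x

theorem isWeylPositive_of_pos (hA : IsGCM (realify A)) {i : I} (hi : A i i ≤ 0)
    (l₀ : List I) (k : I) (h : 0 < formalAct (realify A) l₀ (Finsupp.single k 1) i) :
    IsWeylPositive A (formalAct (realify A) l₀ (Finsupp.single k 1)) := by
  intro l hl
  rw [← formalAct_realify hl, ← formalAct_append]
  apply formalAct_nonneg_of_pos hA _ _ i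
  rw [formalAct_append, formalAct_apply_of_notMem]
  · exact h
  · intro hmem
    have := hl i hmem
    lia

theorem IsWeylPositive.formalRefl (hdiag : ∀ i, A i i = 2 ∨ A i i ≤ 0)
    (hoff : ∀ i j, i ≠ j → A i j ≤ 0) (hA : IsGCM (realify A)) {x : I →₀ ℤ}
    (hx : IsWeylPositive A x) (i : I) : IsWeylPositive A (formalRefl A i x) := by
  intro l hl
  rcases hdiag i with hi | hi
  · have := hx (l ++ [i]) (by
      intro m hm
      rcases List.mem_append.1 hm with hm | hm
      · exact hl m hm
      · rw [List.mem_singleton.1 hm, hi])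
    rw [formalAct_append] at this
    simpa using this
  · have hm := formalPairing_nonpos hoff hi (hx [] (by simp))
    have he := isWeylPositive_of_pos hA hi [] i (by simp) l hl
    rw [formalAct_nil, Module.End.one_apply] at hm he
    rw [formalRefl_apply, map_sub, map_smul, sub_eq_add_neg, ← neg_smul]
    exact add_nonneg (hx l hl) (smul_nonneg (neg_nonneg.2 hm) he)

end BorcherdsCartan

section Realization

variable {I V : Type*} [AddCommGroup V] [Module ℚ V] {A : I → I → ℤ} {α : I → V}
  {coroot : I → (V →ₗ[ℚ] ℚ)}

/-- The element of `h*` given by a formal integral combination of simple roots. -/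
noncomputable def realizeRoot (α : I → V) : (I →₀ ℤ) →ₗ[ℤ] V :=
  Finsupp.linearCombination ℤ α

/-- The functional given by a formal integral combination of simple coroots. -/
noncomputable def realizeCoroot (coroot : I → (V →ₗ[ℚ] ℚ)) : (I →₀ ℤ) →ₗ[ℤ] (V →ₗ[ℚ] ℚ) :=
  Finsupp.linearCombination ℤ coroot

omit [Module ℚ V] in
theorem realizeRoot_single (i : I) : realizeRoot α (Finsupp.single i 1) = α i := by
  simp [realizeRoot, Finsupp.linearCombination_single]

theorem realizeCoroot_single (i : I) :
    realizeCoroot coroot (Finsupp.single i 1) = coroot i := by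
  simp [realizeCoroot, Finsupp.linearCombination_single]

theorem srefl_apply (i : I) (v : V) : srefl α coroot i v = v - coroot i v • α i := rfl

theorem reflRoot_apply (β : V) (βv : V →ₗ[ℚ] ℚ) (v : V) :
    reflRoot β βv v = v - βv v • β := rfl

theorem coroot_realizeRoot (hpair : ∀ i j, coroot i (α j) = (A i j : ℚ)) (i : I) (y : I →₀ ℤ) :
    coroot i (realizeRoot α y) = (formalPairing A i y : ℚ) := by
  induction y using Finsupp.induction_linear with
  | zero => simp
  | add x y hx hy => simp [hx, hy]
  | single j c => simp [realizeRoot, Finsupp.linearCombination_single, hpair]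

theorem realizeCoroot_apply_root (hpair : ∀ i j, coroot i (α j) = (A i j : ℚ)) (x : I →₀ ℤ)
    (i : I) :
    realizeCoroot coroot x (α i) = (formalPairing (fun i j => A j i) i x : ℚ) := by
  induction x using Finsupp.induction_linear with
  | zero => simp
  | add x y hx hy => simp [hx, hy]
  | single j c => simp [realizeCoroot, Finsupp.linearCombination_single, hpair]

theorem realizeRoot_formalRefl (hpair : ∀ i j, coroot i (α j) = (A i j : ℚ)) (i : I)
    (y : I →₀ ℤ) :
    realizeRoot α (formalRefl A i y) = srefl α coroot i (realizeRoot α y) := by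
  rw [formalRefl_apply, map_sub, map_smul, realizeRoot_single, srefl_apply,
    coroot_realizeRoot hpair, Int.cast_smul_eq_zsmul]

theorem realizeCoroot_formalRefl (hpair : ∀ i j, coroot i (α j) = (A i j : ℚ)) (i : I)
    (x : I →₀ ℤ) (v : V) :
    realizeCoroot coroot (formalRefl (fun i j => A j i) i x) v =
      realizeCoroot coroot x (srefl α coroot i v) := by
  rw [formalRefl_apply, map_sub, map_smul, realizeCoroot_single, srefl_apply, map_sub, map_smul,
    realizeCoroot_apply_root hpair, LinearMap.sub_apply, LinearMap.smul_apply, zsmul_eq_mul,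
    smul_eq_mul, mul_comm]

theorem realizeCoroot_nonneg {μ : V} (hμ : ∀ i, 0 ≤ coroot i μ) {x : I →₀ ℤ} (hx : 0 ≤ x) :
    0 ≤ realizeCoroot coroot x μ := by
  unfold realizeCoroot
  rw [Finsupp.linearCombination_apply, Finsupp.sum, LinearMap.sum_apply]
  refine Finset.sum_nonneg fun i _ => ?_
  rw [LinearMap.smul_apply]
  exact smul_nonneg (hx i) (hμ i)

theorem srefl_mul_self (hpair : ∀ i j, coroot i (α j) = (A i j : ℚ)) {i : I} (hi : A i i = 2) :
    srefl α coroot i * srefl α coroot i = 1 := by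
  refine LinearMap.ext fun v => ?_
  simp only [Module.End.mul_apply, Module.End.one_apply, srefl_apply, map_sub, map_smul, hpair,
    hi]
  push_cast
  module

/-- `r_γ r_i = r_i r_{r_i γ}` when `r_i` is an involution on `γ`. -/
theorem reflRoot_mul_srefl (hpair : ∀ i j, coroot i (α j) = (A i j : ℚ)) (i : I)
    {γ γ' β : I →₀ ℤ} (hγ : formalRefl A i γ' = γ) :
    reflRoot (realizeRoot α γ) (realizeCoroot coroot β) * srefl α coroot i =
      srefl α coroot i * reflRoot (realizeRoot α γ')
        (realizeCoroot coroot (formalRefl (fun i j => A j i) i β)) := by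
  refine LinearMap.ext fun v => ?_
  rw [Module.End.mul_apply, Module.End.mul_apply, reflRoot_apply, reflRoot_apply, map_sub,
    map_smul, realizeCoroot_formalRefl hpair, ← realizeRoot_formalRefl hpair, hγ]

theorem realizeCoroot_word_nonneg (hpair : ∀ i j, coroot i (α j) = (A i j : ℚ))
    (hdiag : ∀ i, A i i = 2 ∨ A i i ≤ 0) (hoff : ∀ i j, i ≠ j → A i j ≤ 0)
    (hA : IsGCM (realify A)) {μ : V} (hμ : ∀ i, 0 ≤ coroot i μ) (l : List I) {x : I →₀ ℤ}
    (hx : IsWeylPositive (fun i j => A j i) x) :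
    0 ≤ realizeCoroot coroot x ((l.map (srefl α coroot)).prod μ) := by
  induction l generalizing x with
  | nil => simpa using realizeCoroot_nonneg hμ (hx [] (by simp))
  | cons i l ih =>
    rw [List.map_cons, List.prod_cons, Module.End.mul_apply, ← realizeCoroot_formalRefl hpair]
    exact ih (IsWeylPositive.formalRefl (A := fun i j => A j i) hdiag
      (fun i j h => hoff j i h.symm) (isGCM_realify_transpose hA) hx i)

/-- The exchange property for the monoid generated by all simple reflections: if a positive real
coroot is negative on `τ μ`, the reflection in it removes one letter from any word for `τ`. -/
theorem exists_word_reflRoot_mul (hpair : ∀ i j, coroot i (α j) = (A i j : ℚ))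
    (hdiag : ∀ i, A i i = 2 ∨ A i i ≤ 0) (hoff : ∀ i j, i ≠ j → A i j ≤ 0)
    (hA : IsGCM (realify A)) {μ : V} (hμ : ∀ i, 0 ≤ coroot i μ) (l l₀ : List I) (k : I)
    {γ β : I →₀ ℤ} (hγ : γ = formalAct (realify A) l₀ (Finsupp.single k 1))
    (hβ : β = formalAct (fun i j => realify A j i) l₀ (Finsupp.single k 1))
    (hγ0 : 0 ≤ γ) (hβ0 : 0 ≤ β) (hγim : ∀ i, A i i ≤ 0 → γ i = 0)
    (hβim : ∀ i, A i i ≤ 0 → β i = 0)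
    (hneg : realizeCoroot coroot β ((l.map (srefl α coroot)).prod μ) < 0) :
    ∃ l' : List I, l'.length + 1 = l.length ∧
      reflRoot (realizeRoot α γ) (realizeCoroot coroot β) * (l.map (srefl α coroot)).prod =
        (l'.map (srefl α coroot)).prod := by
  induction l generalizing l₀ γ β with
  | nil => exact absurd (realizeCoroot_nonneg hμ hβ0) (not_le.2 (by simpa using hneg))
  | cons i l ih =>
    have htr := realify_transpose (A := A)
    rw [List.map_cons, List.prod_cons, Module.End.mul_apply,
      ← realizeCoroot_formalRefl hpair] at hneg
    rw [List.map_cons, List.prod_cons, ← mul_assoc]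
    rcases hdiag i with hi | hi
    · have eγ : formalRefl (realify A) i = formalRefl A i := formalRefl_realify_of_eq_two hi
      have eβ : formalRefl (fun i j => realify A j i) i = formalRefl (fun i j => A j i) i := by
        rw [← htr]
        exact formalRefl_realify_of_eq_two (A := fun i j => A j i) hi
      have hγ' : formalRefl A i γ = formalAct (realify A) (i :: l₀) (Finsupp.single k 1) := by
        rw [formalAct_cons, eγ, hγ]
      have hβ' : formalRefl (fun i j => A j i) i β =
          formalAct (fun i j => realify A j i) (i :: l₀) (Finsupp.single k 1) := by
        rw [formalAct_cons, eβ, hβ]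
      have hsign := formalAct_sign_coherent hA (i :: l₀) k
      rw [← hγ', ← hβ'] at hsign
      rcases hsign with ⟨h1, h2⟩ | ⟨h1, h2⟩
      · have hne : ∀ m, A m m ≤ 0 → m ≠ i := by
          rintro m hm rfl
          lia
        obtain ⟨l', hl', hprod⟩ := ih (i :: l₀) hγ' hβ' h1 h2
          (fun m hm => by rw [formalRefl_apply_of_ne (hne m hm), hγim m hm])
          (fun m hm => by rw [formalRefl_apply_of_ne (hne m hm), hβim m hm]) hneg
        refine ⟨i :: l', by simp [hl'], ?_⟩
        have hinv : formalRefl A i (formalRefl A i γ) = γ :=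
          LinearMap.congr_fun (formalRefl_mul_self hi) γ
        rw [reflRoot_mul_srefl hpair i hinv, mul_assoc, hprod, List.map_cons, List.prod_cons]
      · obtain ⟨e1, e2⟩ := eq_single_of_formalRefl_nonpos hA l₀ k i hγ hβ hγ0 hβ0
          (by rwa [eγ]) (by rwa [eβ])
        refine ⟨l, by simp, ?_⟩
        rw [e1, e2, realizeRoot_single, realizeCoroot_single]
        change srefl α coroot i * srefl α coroot i * _ = _
        rw [srefl_mul_self hpair hi, one_mul]
    · have hreal : formalPairing (fun i j => realify A j i) i β =
          formalPairing (fun i j => A j i) i β := by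
        rw [← htr]
        exact formalPairing_realify (A := fun i j => A j i) (hβim i hi)
      by_cases hm : formalPairing (fun i j => A j i) i β = 0
      · have hm' : formalPairing A i γ = 0 := by
          rw [← formalPairing_realify (hγim i hi), hγ]
          apply formalPairing_eq_zero_of_transpose hA
          rw [← hβ, hreal, hm]
        have hγfix : formalRefl A i γ = γ := by
          rw [formalRefl_apply, hm', zero_smul, sub_zero]
        have hβfix : formalRefl (fun i j => A j i) i β = β := by
          rw [formalRefl_apply, hm, zero_smul, sub_zero]
        rw [hβfix] at hneg
        obtain ⟨l', hl', hprod⟩ := ih l₀ hγ hβ hγ0 hβ0 hγim hβim hneg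
        refine ⟨i :: l', by simp [hl'], ?_⟩
        rw [reflRoot_mul_srefl hpair i hγfix, hβfix, mul_assoc, hprod, List.map_cons,
          List.prod_cons]
      · exfalso
        have hle := formalPairing_nonpos (A := fun i j => A j i)
          (fun i j h => hoff j i h.symm) hi hβ0
        have hx : formalRefl (fun i j => A j i) i β =
            formalAct (realify fun i j => A j i) (i :: l₀) (Finsupp.single k 1) := by
          rw [htr, formalAct_cons, ← hβ, formalRefl_apply, formalRefl_apply, hreal]
        refine absurd hneg (not_lt.2 (realizeCoroot_word_nonneg hpair hdiag hoff hA hμ l ?_))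
        rw [hx]
        refine isWeylPositive_of_pos (isGCM_realify_transpose hA) (i := i) hi _ _ ?_
        rw [← hx, formalRefl_apply]
        simp only [Finsupp.coe_sub, Finsupp.coe_smul, Pi.sub_apply, Pi.smul_apply,
          Finsupp.single_eq_same, hβim i hi, smul_eq_mul]
        lia

theorem exists_word_of_mem_Tmon {τ : Module.End ℚ V} (hτ : τ ∈ Tmon α coroot) :
    ∃ l : List I, (l.map (srefl α coroot)).prod = τ := by
  obtain ⟨l, hl, rfl⟩ := Submonoid.exists_list_of_mem_closure hτ
  obtain ⟨l', rfl⟩ : l ∈ Set.range (List.map (srefl α coroot)) := by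
    rwa [Set.range_list_map]
  exact ⟨l', rfl⟩

end Realization

end GKM


open GKM in
/-- If `μ ∈ P^+`, `τ ∈ T`, `j` is real and `α_j^∨(τμ) < 0`, then `ℓ(r_j τ) < ℓ(τ)`. -/
theorem stmt2 {I V : Type*} [Countable I] [AddCommGroup V] [Module ℚ V]
    (A : I → I → ℤ) (α : I → V) (coroot : I → (V →ₗ[ℚ] ℚ))
    (hind : LinearIndependent ℚ α)
    (hpair : ∀ i j, coroot i (α j) = (A i j : ℚ))
    (hdiag : ∀ i, A i i = 2 ∨ A i i ≤ 0)
    (hoff : ∀ i j, i ≠ j → A i j ≤ 0)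
    (hzero : ∀ i j, A i j = 0 ↔ A j i = 0)
    (μ : V) (hμ : μ ∈ Pplus coroot)
    (τ : Module.End ℚ V) (hτ : τ ∈ Tmon α coroot)
    (j : I) (hj : A j j = 2) (hneg : coroot j (τ μ) < 0) :
    lenT α coroot (srefl α coroot j * τ) < lenT α coroot τ := by
  obtain ⟨l, hlen, rfl⟩ : ∃ l : List I, l.length = lenT α coroot τ ∧
      (l.map (srefl α coroot)).prod = τ := by
    obtain ⟨l, hl⟩ := exists_word_of_mem_Tmon hτ
    exact Nat.sInf_mem (s := {n | ∃ l : List I, l.length = n ∧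
      (l.map (srefl α coroot)).prod = τ}) ⟨l.length, l, rfl, hl⟩
  have hsingle : (0 : I →₀ ℤ) ≤ Finsupp.single j 1 := Finsupp.single_nonneg.2 zero_le_one
  have him : ∀ i, A i i ≤ 0 → (Finsupp.single j 1 : I →₀ ℤ) i = 0 := by
    intro i hi
    refine Finsupp.single_eq_of_ne ?_
    rintro rfl
    lia
  obtain ⟨l', hl', hprod⟩ := exists_word_reflRoot_mul hpair hdiag hoff
    (isGCM_realify hoff hzero) hμ.2 l [] j (γ := Finsupp.single j 1) (β := Finsupp.single j 1)
    (by simp) (by simp) hsingle hsingle him him (by rwa [realizeCoroot_single])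
  rw [realizeRoot_single, realizeCoroot_single] at hprod
  have hle : lenT α coroot (srefl α coroot j * (l.map (srefl α coroot)).prod) ≤ l'.length :=
    Nat.sInf_le ⟨l', rfl, hprod.symm⟩
  lia
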